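/- For every δ ∈ (0,1), the chain consistency probability of the embedded star Hamiltonian satisfies P_cc(λ) ≥ δ if and only if cosh^l(z) + cosh^{−l}(z) ≤ (2·(1−δ)/δ)·e^{z·λ}. -/

import Mathlib

open Finset Real

/-- Spin value of a boolean: `true ↦ +1`, `false ↦ -1`. -/
noncomputable def spin (b : Bool) : ℝ := if b then 1 else -1

/-- The embedded star Hamiltonian
`H_e^λ = -λ·s₁·s₂ + (s₁+1)·(x₁+⋯+x_l) + (s₂-1)·(y₁+⋯+y_l)` on configurations
`σ = (s₁, s₂, x, y)`. -/
noncomputable def He (l : ℕ) (lam : ℝ)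
    (σ : Bool × Bool × (Fin l → Bool) × (Fin l → Bool)) : ℝ :=
  -lam * spin σ.1 * spin σ.2.1 + (spin σ.1 + 1) * (∑ i, spin (σ.2.2.1 i)) +
    (spin σ.2.1 - 1) * (∑ i, spin (σ.2.2.2 i))

/-- The partition function of `l` free spins in a field `c`. -/
lemma sum_exp_mul_sum_spin (l : ℕ) (c : ℝ) :
    ∑ x : Fin l → Bool, exp (c * ∑ i, spin (x i)) = (2 * cosh c) ^ l := by
  have h := Finset.prod_univ_sum (fun _ : Fin l => (univ : Finset Bool))
    (fun _ b => exp (c * spin b))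
  simp only [Fintype.piFinset_univ, prod_const, card_univ, Fintype.card_fin] at h
  simp_rw [mul_sum, exp_sum, ← h]
  simp [spin, cosh_eq]
  ring

/-- The Gibbs weight of fixed centre spins `s₁ = a`, `s₂ = b`. -/
lemma sum_exp_neg_mul_He (l : ℕ) (lam β : ℝ) (a b : Bool) :
    ∑ p : (Fin l → Bool) × (Fin l → Bool), exp (-β * He l lam (a, b, p)) =
      exp (β * lam * (spin a * spin b)) * (2 * cosh (β * (spin a + 1))) ^ l *
        (2 * cosh (β * (spin b - 1))) ^ l := by
  rw [← cosh_neg (β * (spin a + 1)), ← cosh_neg (β * (spin b - 1)),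
    ← sum_exp_mul_sum_spin, ← sum_exp_mul_sum_spin, mul_assoc, sum_mul_sum, mul_sum,
    Fintype.sum_prod_type]
  refine sum_congr rfl fun x _ => ?_
  rw [mul_sum]
  refine sum_congr rfl fun y _ => ?_
  rw [← exp_add, ← exp_add, He]
  congr 1
  ring

/-- **Threshold characterization of chain consistency.**
For every `δ ∈ (0,1)`, the chain consistency probability `P_cc(λ)` of the
embedded star Hamiltonian satisfies `P_cc(λ) ≥ δ` if and only if
`cosh^l z + cosh^{-l} z ≤ (2(1-δ)/δ)·e^{z·λ}`. -/
theorem star_chain_consistency_threshold (l : ℕ) (hl : 1 ≤ l) (lam βeff : ℝ)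
    (hlam : 0 < lam) (hβ : 0 < βeff) (z : ℝ) (hz : z = 2 * βeff)
    (δ : ℝ) (hδ0 : 0 < δ) (hδ1 : δ < 1) :
    δ ≤ (∑ σ ∈ Finset.univ.filter
            (fun σ : Bool × Bool × (Fin l → Bool) × (Fin l → Bool) => σ.1 = σ.2.1),
          Real.exp (-βeff * He l lam σ)) /
        (∑ σ : Bool × Bool × (Fin l → Bool) × (Fin l → Bool),
          Real.exp (-βeff * He l lam σ)) ↔
      Real.cosh z ^ l + (Real.cosh z ^ l)⁻¹ ≤ 2 * (1 - δ) / δ * Real.exp (z * lam) := by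
  have hC : 0 < cosh z ^ l := pow_pos (cosh_pos z) l
  have hbeta : βeff * 2 = z := by rw [hz, mul_comm]
  have hexp : exp (z * lam) = exp (βeff * lam) * exp (βeff * lam) := by
    rw [← exp_add, hz]; ring_nf
  rw [sum_filter]
  simp only [Fintype.sum_prod_type (α₁ := Bool)]
  simp only [Fintype.sum_bool, if_true, reduceCtorEq, if_false, sum_const_zero,
    sum_exp_neg_mul_He]
  norm_num [spin, hbeta, exp_neg, mul_pow]
  rw [hexp]
  generalize cosh z ^ l = C at *
  have hE := exp_pos (βeff * lam)
  generalize exp (βeff * lam) = E at *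
  have hT : (0 : ℝ) < 2 ^ l := by positivity
  generalize (2 : ℝ) ^ l = T at *
  rw [le_div_iff₀ (by positivity), ← sub_nonneg, ← sub_nonneg (b := C + C⁻¹),
    ← mul_nonneg_iff_of_pos_left (b := _ - (C + C⁻¹))
      (show 0 < T ^ 2 * δ * C * E⁻¹ by positivity)]
  apply iff_of_eq
  congr 1
  field_simp
  ring
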